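/- arXiv:2101.01545 — 5 statements merged into one kernel-verified Lean document; each statement's English description precedes it below -/
import Mathlib

section
/- Let Φ be a Young function, 0 ≤ λ ≤ 1 and r, t > 0. Then ‖χ_{B_t}‖_{Φ,λ,B_r} = 1 / Φ⁻¹(|B_r|^λ / |B_r ∩ B_t|), and consequently ‖χ_{B_t}‖_{M^{Φ,λ}(0)} = sup_{r>0} ‖χ_{B_t}‖_{Φ,λ,B_r} = 1 / Φ⁻¹(|B_t|^{λ−1}). -/
open MeasureTheory Metric Set Filter ENNReal NNReal Topology

noncomputable section

/-- ℝⁿ as Euclidean space. -/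
abbrev Eu (n : ℕ) : Type := EuclideanSpace ℝ (Fin n)

/-- The (right-continuous) generalized inverse `Φ⁻¹(v) = inf {u ≥ 0 : Φ(u) > v}`
(with `inf ∅ = ∞`). -/
def yInv (Φ : ℝ≥0∞ → ℝ≥0∞) (v : ℝ≥0∞) : ℝ≥0∞ := sInf {u : ℝ≥0∞ | v < Φ u}

/-- The complementary (conjugate) function `Φ*(v) = sup_{u > 0} (u⬝v − Φ(u))`. -/
def yConj (Φ : ℝ≥0∞ → ℝ≥0∞) (v : ℝ≥0∞) : ℝ≥0∞ :=
  ⨆ (u : ℝ≥0∞) (_ : 0 < u) (_ : u ≠ ∞), u * v - Φ u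

/-- The dilation function `s_{Φ⁻¹}(t) = sup_{s > 0} Φ⁻¹(st)/Φ⁻¹(s)`. -/
def sDil (Φ : ℝ≥0∞ → ℝ≥0∞) (t : ℝ≥0∞) : ℝ≥0∞ :=
  ⨆ (s : ℝ≥0∞) (_ : 0 < s) (_ : s ≠ ∞), yInv Φ (s * t) / yInv Φ s

/-- A Young function: nondecreasing, convex, `Φ(0) = 0 = lim_{u→0+} Φ(u)`, not identically
`0` nor `∞` on `(0,∞)`, and left continuous (values in `[0,∞]`, the value at `∞` being the
canonical/limit extension). -/
structure IsYoungFn (Φ : ℝ≥0∞ → ℝ≥0∞) : Prop where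
  mono : Monotone Φ
  map_zero : Φ 0 = 0
  tendsto_zero : Filter.Tendsto Φ (nhdsWithin 0 (Set.Ioi 0)) (nhds 0)
  convex : ∀ a b t : ℝ≥0∞, t ≤ 1 → Φ (t * a + (1 - t) * b) ≤ t * Φ a + (1 - t) * Φ b
  not_zero : ∃ u : ℝ≥0∞, 0 < u ∧ u ≠ ∞ ∧ Φ u ≠ 0
  not_top : ∃ u : ℝ≥0∞, 0 < u ∧ u ≠ ∞ ∧ Φ u ≠ ∞
  left_cont : ∀ u : ℝ≥0∞, 0 < u → Filter.Tendsto Φ (nhdsWithin u (Set.Iio u)) (nhds (Φ u))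

/-- An Orlicz function: increasing, continuous, convex, `Φ(0) = 0`, finite on `[0,∞)`
(the value at `∞` being the canonical extension `Φ(∞) = ∞`). -/
structure IsOrliczFn (Φ : ℝ≥0∞ → ℝ≥0∞) : Prop where
  map_zero : Φ 0 = 0
  strictMono : StrictMono Φ
  continuous : Continuous Φ
  convex : ∀ a b t : ℝ≥0∞, t ≤ 1 → Φ (t * a + (1 - t) * b) ≤ t * Φ a + (1 - t) * Φ b
  finite : ∀ u : ℝ≥0∞, u ≠ ∞ → Φ u ≠ ∞
  map_top : Φ ∞ = ∞

/-- The Δ₂-condition: `0 < Φ(u) < ∞` for `0 < u < ∞` and `Φ(2u) ≤ D₂ Φ(u)` for some `D₂ ≥ 1`. -/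
def IsDelta2 (Φ : ℝ≥0∞ → ℝ≥0∞) : Prop :=
  (∀ u : ℝ≥0∞, 0 < u → u ≠ ∞ → 0 < Φ u ∧ Φ u ≠ ∞) ∧
    ∃ D : ℝ≥0∞, 1 ≤ D ∧ D ≠ ∞ ∧ ∀ u : ℝ≥0∞, u ≠ ∞ → Φ (2 * u) ≤ D * Φ u

/-- The Luxemburg-type functional `‖f‖_{Φ,λ,A}`. -/
def orliczNorm {n : ℕ} (Φ : ℝ≥0∞ → ℝ≥0∞) (lam : ℝ) (A : Set (Eu n)) (f : Eu n → ℝ) : ℝ≥0∞ :=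
  sInf {ε : ℝ≥0∞ | 0 < ε ∧ ε ≠ ∞ ∧
    volume A ^ (-lam) * ∫⁻ x in A, Φ ((‖f x‖₊ : ℝ≥0∞) / ε) ≤ 1}

/-- The weak Luxemburg-type functional `‖f‖_{Φ,λ,A,∞}`. -/
def orliczWeakNorm {n : ℕ} (Φ : ℝ≥0∞ → ℝ≥0∞) (lam : ℝ) (A : Set (Eu n)) (f : Eu n → ℝ) : ℝ≥0∞ :=
  sInf {ε : ℝ≥0∞ | 0 < ε ∧ ε ≠ ∞ ∧
    (⨆ (u : ℝ≥0) (_ : 0 < u),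
      Φ ((u : ℝ≥0∞) / ε) * (volume A ^ (-lam) * volume {x ∈ A | u < ‖f x‖₊})) ≤ 1}

/-- The central Morrey–Orlicz norm `‖f‖_{M^{Φ,λ}(0)} = sup_{r>0} ‖f‖_{Φ,λ,B_r}`. -/
def centralNorm {n : ℕ} (Φ : ℝ≥0∞ → ℝ≥0∞) (lam : ℝ) (f : Eu n → ℝ) : ℝ≥0∞ :=
  ⨆ (r : ℝ) (_ : 0 < r), orliczNorm Φ lam (ball (0 : Eu n) r) f

/-- The weak central Morrey–Orlicz norm `‖f‖_{WM^{Φ,λ}(0)} = sup_{r>0} ‖f‖_{Φ,λ,B_r,∞}`. -/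
def centralWeakNorm {n : ℕ} (Φ : ℝ≥0∞ → ℝ≥0∞) (lam : ℝ) (f : Eu n → ℝ) : ℝ≥0∞ :=
  ⨆ (r : ℝ) (_ : 0 < r), orliczWeakNorm Φ lam (ball (0 : Eu n) r) f

/-- The Riesz potential `I_α f(x) = ∫ f(y) |x−y|^{α−n} dy`. -/
def riesz {n : ℕ} (α : ℝ) (f : Eu n → ℝ) (x : Eu n) : ℝ :=
  ∫ y, f y / ‖x - y‖ ^ ((n : ℝ) - α)

/-- The classical Morrey norm `‖f‖_{M^{p,λ}}`. -/
def morreyNormP {n : ℕ} (p lam : ℝ) (f : Eu n → ℝ) : ℝ≥0∞ :=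
  ⨆ (x₀ : Eu n) (r : ℝ) (_ : 0 < r),
    (volume (ball x₀ r) ^ (-lam) * ∫⁻ x in ball x₀ r, (‖f x‖₊ : ℝ≥0∞) ^ p) ^ (1 / p)

/-- The classical central Morrey norm `‖f‖_{M^{p,λ}(0)}`. -/
def centralNormP {n : ℕ} (p lam : ℝ) (f : Eu n → ℝ) : ℝ≥0∞ :=
  ⨆ (r : ℝ) (_ : 0 < r),
    (volume (ball (0 : Eu n) r) ^ (-lam) * ∫⁻ x in ball (0 : Eu n) r, (‖f x‖₊ : ℝ≥0∞) ^ p) ^ (1 / p)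

theorem yInv_mono (Φ : ℝ≥0∞ → ℝ≥0∞) : Monotone (yInv Φ) := fun _ _ h =>
  sInf_le_sInf fun _ hu => lt_of_le_of_lt h hu

theorem sInf_le_apply_inv_eq_inv_yInv {Φ : ℝ≥0∞ → ℝ≥0∞} (hΦ : Monotone Φ) (c : ℝ≥0∞) :
    sInf {ε : ℝ≥0∞ | 0 < ε ∧ ε ≠ ∞ ∧ Φ ε⁻¹ ≤ c} = (yInv Φ c)⁻¹ := by
  apply le_antisymm
  · refine le_of_forall_gt fun b hb => ?_
    obtain ⟨d, hd, hdb⟩ := exists_between hb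
    refine lt_of_le_of_lt (sInf_le ⟨pos_of_gt hd, hdb.ne_top, ?_⟩) hdb
    by_contra! h
    exact (ENNReal.inv_lt_iff_inv_lt.1 hd).not_ge (sInf_le h)
  · refine le_sInf fun ε hε => ENNReal.inv_le_iff_inv_le.1 (le_sInf fun u hu => ?_)
    by_contra! h
    exact (lt_of_lt_of_le hu (hΦ h.le)).not_ge hε.2.2

theorem lintegral_comp_indicator_one_div {n : ℕ} {Φ : ℝ≥0∞ → ℝ≥0∞} (h0 : Φ 0 = 0)
    (A : Set (Eu n)) {B : Set (Eu n)} (hB : MeasurableSet B) (ε : ℝ≥0∞) :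
    ∫⁻ x in A, Φ ((‖B.indicator (1 : Eu n → ℝ) x‖₊ : ℝ≥0∞) / ε) =
      Φ ε⁻¹ * volume (A ∩ B) := by
  have h : (fun x => Φ ((‖B.indicator (1 : Eu n → ℝ) x‖₊ : ℝ≥0∞) / ε)) =
      B.indicator fun _ => Φ ε⁻¹ := by
    ext x
    by_cases hx : x ∈ B <;> simp [hx, h0]
  rw [h, lintegral_indicator_const hB, Measure.restrict_apply hB, inter_comm]

theorem orliczNorm_indicator_one {n : ℕ} {Φ : ℝ≥0∞ → ℝ≥0∞} (hΦ : IsYoungFn Φ) (lam : ℝ)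
    {A B : Set (Eu n)} (hB : MeasurableSet B) (hA : volume A ≠ ∞)
    (hAB : volume (A ∩ B) ≠ 0) :
    orliczNorm Φ lam A (B.indicator 1) = 1 / yInv Φ (volume A ^ lam / volume (A ∩ B)) := by
  have hle : volume (A ∩ B) ≤ volume A := measure_mono inter_subset_left
  have hA0 : volume A ≠ 0 := (pos_iff_ne_zero.2 hAB |>.trans_le hle).ne'
  have hAB' : volume (A ∩ B) ≠ ∞ := ne_top_of_le_ne_top hA hle
  have hp0 : volume A ^ lam ≠ 0 := (ENNReal.rpow_pos (pos_iff_ne_zero.2 hA0) hA).ne'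
  have hpt : volume A ^ lam ≠ ∞ := ENNReal.rpow_ne_top_of_ne_zero hA0 hA
  rw [one_div, ← sInf_le_apply_inv_eq_inv_yInv hΦ.mono, orliczNorm]
  congr 1
  ext ε
  refine and_congr_right fun _ => and_congr_right fun _ => ?_
  rw [lintegral_comp_indicator_one_div hΦ.map_zero A hB, ENNReal.rpow_neg, mul_comm,
    ← div_eq_mul_inv, ENNReal.div_le_iff hp0 hpt, one_mul,
    ENNReal.le_div_iff_mul_le (Or.inl hAB) (Or.inl hAB')]

theorem rpow_sub_one_le_rpow_div {a b m : ℝ≥0∞} {lam : ℝ} (hlam0 : 0 ≤ lam) (hlam1 : lam ≤ 1)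
    (hb0 : b ≠ 0) (hb : b ≠ ∞) (ha0 : a ≠ 0) (ha : a ≠ ∞) (hma : m ≤ a) (hmb : m ≤ b) :
    b ^ (lam - 1) ≤ a ^ lam / m := by
  rcases le_total a b with h | h
  · calc
      b ^ (lam - 1) ≤ a ^ (lam - 1) := by
          rw [← neg_sub, ENNReal.rpow_neg, ENNReal.rpow_neg]
          exact ENNReal.inv_le_inv.2 (ENNReal.rpow_le_rpow h (sub_nonneg.2 hlam1))
      _ = a ^ lam / a := by rw [ENNReal.rpow_sub _ _ ha0 ha, ENNReal.rpow_one]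
      _ ≤ a ^ lam / m := ENNReal.div_le_div_left hma _
  · rw [ENNReal.rpow_sub _ _ hb0 hb, ENNReal.rpow_one]
    exact ENNReal.div_le_div (ENNReal.rpow_le_rpow h hlam0) hmb

/-- the Luxemburg functional and the central Morrey–Orlicz norm of `χ_{B_t}`. -/
theorem statement4 {n : ℕ} (Φ : ℝ≥0∞ → ℝ≥0∞) (hΦ : IsYoungFn Φ) (lam : ℝ)
    (hlam0 : 0 ≤ lam) (hlam1 : lam ≤ 1) (r t : ℝ) (hr : 0 < r) (ht : 0 < t) :
    orliczNorm Φ lam (ball (0 : Eu n) r) ((ball (0 : Eu n) t).indicator 1) =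
      1 / yInv Φ (volume (ball (0 : Eu n) r) ^ lam / volume (ball (0 : Eu n) r ∩ ball (0 : Eu n) t)) ∧
    centralNorm Φ lam ((ball (0 : Eu n) t).indicator 1) =
      1 / yInv Φ (volume (ball (0 : Eu n) t) ^ (lam - 1)) := by
  have hpos : ∀ s : ℝ, 0 < s → volume (ball (0 : Eu n) s) ≠ 0 := fun s hs =>
    (measure_ball_pos _ _ hs).ne'
  have htop : ∀ s : ℝ, volume (ball (0 : Eu n) s) ≠ ∞ := fun s => measure_ball_lt_top.ne
  have hnorm : ∀ s : ℝ, 0 < s →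
      orliczNorm Φ lam (ball (0 : Eu n) s) ((ball (0 : Eu n) t).indicator 1) =
        1 / yInv Φ (volume (ball (0 : Eu n) s) ^ lam /
          volume (ball (0 : Eu n) s ∩ ball (0 : Eu n) t)) := fun s hs => by
    refine orliczNorm_indicator_one hΦ lam measurableSet_ball (htop s) ?_
    refine ((measure_ball_pos volume (0 : Eu n) (lt_min hs ht)).trans_le
      (measure_mono ?_)).ne'
    exact subset_inter (ball_subset_ball (min_le_left s t)) (ball_subset_ball (min_le_right s t))
  refine ⟨hnorm r hr, le_antisymm (iSup₂_le fun s hs => ?_) ?_⟩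
  · rw [hnorm s hs]
    exact ENNReal.div_le_div_left (yInv_mono Φ (rpow_sub_one_le_rpow_div hlam0 hlam1
      (hpos t ht) (htop t) (hpos s hs) (htop s) (measure_mono inter_subset_left)
      (measure_mono inter_subset_right))) 1
  · refine le_iSup₂_of_le t ht ?_
    rw [hnorm t ht, inter_self, ENNReal.rpow_sub _ _ (hpos t ht) (htop t), ENNReal.rpow_one]
end
end

section
/- Let Φ be a Young function, 0 ≤ λ ≤ 1 and r, t > 0. Then ‖χ_{B_t}‖_{Φ,λ,B_r,∞} = 1 / Φ⁻¹(|B_r|^λ / |B_r ∩ B_t|), and consequently ‖χ_{B_t}‖_{WM^{Φ,λ}(0)} = sup_{r>0} ‖χ_{B_t}‖_{Φ,λ,B_r,∞} = 1 / Φ⁻¹(|B_t|^{λ−1}). -/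
open MeasureTheory Metric Set Filter ENNReal NNReal Topology

noncomputable section

theorem le_yInv_of_le {Φ : ℝ≥0∞ → ℝ≥0∞} (hΦ : Monotone Φ) {u v : ℝ≥0∞} (h : Φ u ≤ v) :
    u ≤ yInv Φ v :=
  le_sInf fun _ hw => (hΦ.reflect_lt (h.trans_lt hw)).le

theorem apply_le_of_lt_yInv {Φ : ℝ≥0∞ → ℝ≥0∞} {u v : ℝ≥0∞} (h : u < yInv Φ v) : Φ u ≤ v :=
  not_lt.1 fun hlt => notMem_of_lt_csInf h (OrderBot.bddBelow _) hlt

/-- The distribution function of a characteristic function. -/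
theorem setOf_lt_nnnorm_indicator_one {α : Type*} (A S : Set α) (u : ℝ≥0) :
    {x ∈ A | u < ‖S.indicator (1 : α → ℝ) x‖₊} = if u < 1 then A ∩ S else ∅ := by
  ext x
  by_cases hx : x ∈ S <;> split_ifs with hu <;> simp [hx, hu]

theorem orliczWeakNorm_indicator_one {n : ℕ} {Φ : ℝ≥0∞ → ℝ≥0∞} (hΦ : Monotone Φ) (lam : ℝ)
    {A S : Set (Eu n)} (hA₀ : volume A ≠ 0) (hA : volume A ≠ ∞) (hAS : volume (A ∩ S) ≠ 0) :
    orliczWeakNorm Φ lam A (S.indicator 1) =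
      1 / yInv Φ (volume A ^ lam / volume (A ∩ S)) := by
  have hAS' : volume (A ∩ S) ≠ ∞ := measure_ne_top_of_subset inter_subset_left hA
  set a := volume A ^ lam / volume (A ∩ S) with ha
  have hmul : ∀ w : ℝ≥0∞, w * (volume A ^ (-lam) * volume (A ∩ S)) ≤ 1 ↔ w ≤ a := by
    intro w
    have hinv : volume A ^ (-lam) * volume (A ∩ S) = a⁻¹ := by
      rw [ha, ENNReal.inv_div (Or.inl hAS') (Or.inl hAS), ENNReal.rpow_neg, mul_comm,
        div_eq_mul_inv]
    have ha₀ : a ≠ 0 := ENNReal.div_ne_zero.2 ⟨by simp [ENNReal.rpow_eq_zero_iff, hA₀, hA], hAS'⟩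
    have ha' : a ≠ ∞ := ENNReal.div_ne_top (ENNReal.rpow_ne_top_of_ne_zero hA₀ hA) hAS
    rw [hinv, ← div_eq_mul_inv, ENNReal.div_le_iff ha₀ ha', one_mul]
  have hiff : ∀ ε : ℝ≥0∞, (⨆ (u : ℝ≥0) (_ : 0 < u), Φ ((u : ℝ≥0∞) / ε) *
      (volume A ^ (-lam) * volume {x ∈ A | u < ‖S.indicator (1 : Eu n → ℝ) x‖₊})) ≤ 1 ↔
      ∀ u : ℝ≥0, 0 < u → u < 1 → Φ ((u : ℝ≥0∞) / ε) ≤ a := by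
    intro ε
    simp only [iSup_le_iff, setOf_lt_nnnorm_indicator_one]
    refine forall₂_congr fun u _ => ?_
    split_ifs with hu <;> simp [hu, hmul]
  simp only [orliczWeakNorm, hiff, one_div]
  apply le_antisymm
  · refine le_of_forall_gt_imp_ge_of_dense fun ε hε => ?_
    rcases eq_or_ne ε ∞ with rfl | hε'
    · exact le_top
    refine sInf_le ⟨bot_lt_of_lt hε, hε', fun u _ hu => apply_le_of_lt_yInv ?_⟩
    calc (u : ℝ≥0∞) / ε ≤ 1 / ε := by gcongr; exact_mod_cast hu.le
      _ = ε⁻¹ := one_div ε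
      _ < yInv Φ a := ENNReal.inv_lt_iff_inv_lt.1 hε
  · refine le_sInf fun ε ⟨hε, hε', h⟩ => ENNReal.inv_le_iff_inv_le.1 ?_
    refine le_of_forall_lt_imp_le_of_dense fun w hw => ?_
    rcases eq_or_ne w 0 with rfl | hw₀
    · exact zero_le
    have hlt : w * ε < 1 := by
      rwa [← ENNReal.lt_div_iff_mul_lt (Or.inl hε.ne') (Or.inl hε'), one_div]
    lift w * ε to ℝ≥0 using hlt.ne_top with u hu
    have hu₀ : 0 < u := by
      rw [← ENNReal.coe_pos, hu]
      exact ENNReal.mul_pos hw₀ hε.ne'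
    have hΦu := le_yInv_of_le hΦ (h u hu₀ (by exact_mod_cast hlt))
    rwa [hu, ENNReal.mul_div_cancel_right hε.ne' hε'] at hΦu

theorem rpow_sub_one_le_rpow_div_s5 {x y v : ℝ≥0∞} {lam : ℝ} (hlam0 : 0 ≤ lam) (hlam1 : lam ≤ 1)
    (hv₀ : v ≠ 0) (hv : v ≠ ∞) (hx : v ≤ x) (hy : v ≤ y) : y ^ (lam - 1) ≤ x ^ lam / v :=
  calc y ^ (lam - 1) ≤ v ^ (lam - 1) := by
        rw [← neg_sub, ENNReal.rpow_neg, ENNReal.rpow_neg, ENNReal.inv_le_inv]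
        exact ENNReal.rpow_le_rpow hy (sub_nonneg.2 hlam1)
    _ = v ^ lam / v := by rw [ENNReal.rpow_sub _ _ hv₀ hv, ENNReal.rpow_one]
    _ ≤ x ^ lam / v := by gcongr

/-- the weak Luxemburg functional and the weak central Morrey–Orlicz norm of `χ_{B_t}`. -/
theorem statement5 {n : ℕ} (Φ : ℝ≥0∞ → ℝ≥0∞) (hΦ : IsYoungFn Φ) (lam : ℝ)
    (hlam0 : 0 ≤ lam) (hlam1 : lam ≤ 1) (r t : ℝ) (hr : 0 < r) (ht : 0 < t) :
    orliczWeakNorm Φ lam (ball (0 : Eu n) r) ((ball (0 : Eu n) t).indicator 1) =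
      1 / yInv Φ (volume (ball (0 : Eu n) r) ^ lam / volume (ball (0 : Eu n) r ∩ ball (0 : Eu n) t)) ∧
    centralWeakNorm Φ lam ((ball (0 : Eu n) t).indicator 1) =
      1 / yInv Φ (volume (ball (0 : Eu n) t) ^ (lam - 1)) := by
  have hpos : ∀ s : ℝ, 0 < s → volume (ball (0 : Eu n) s) ≠ 0 :=
    fun s hs => (measure_ball_pos volume 0 hs).ne'
  have hfin : ∀ s : ℝ, volume (ball (0 : Eu n) s) ≠ ∞ := fun s => measure_ball_lt_top.ne
  have hinter : ∀ s : ℝ, 0 < s → volume (ball (0 : Eu n) s ∩ ball (0 : Eu n) t) ≠ 0 := by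
    intro s hs
    have hsub : ball (0 : Eu n) (min s t) ⊆ ball 0 s ∩ ball 0 t :=
      subset_inter (ball_subset_ball (min_le_left _ _)) (ball_subset_ball (min_le_right _ _))
    exact ((measure_ball_pos volume 0 (lt_min hs ht)).trans_le (measure_mono hsub)).ne'
  have key : ∀ s : ℝ, 0 < s → _ := fun s hs =>
    orliczWeakNorm_indicator_one hΦ.mono lam (hpos s hs) (hfin s) (hinter s hs)
  refine ⟨key r hr, le_antisymm (iSup₂_le fun s hs => ?_) ?_⟩
  · rw [key s hs]
    exact ENNReal.div_le_div_left (yInv_mono Φ (rpow_sub_one_le_rpow_div_s5 hlam0 hlam1 (hinter s hs)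
      (measure_ne_top_of_subset inter_subset_left (hfin s))
      (measure_mono inter_subset_left) (measure_mono inter_subset_right))) 1
  · refine le_iSup₂_of_le t ht (le_of_eq ?_)
    rw [key t ht, inter_self, ENNReal.rpow_sub _ _ (hpos t ht) (hfin t), ENNReal.rpow_one]
end
end

section
/- Let Φ be an Orlicz function, 0 ≤ λ ≤ 1 and a > 0, and let D_a f(x) = f(ax) be the dilation operator. Then D_a is a bounded operator on the central Morrey–Orlicz space M^{Φ,λ}(0) and its operator norm equals s_{Φ⁻¹}(a^{n(λ−1)}); that is, ‖D_a f‖_{M^{Φ,λ}(0)} ≤ s_{Φ⁻¹}(a^{n(λ−1)}) ‖f‖_{M^{Φ,λ}(0)} for all f ∈ M^{Φ,λ}(0), and sup{‖D_a f‖_{M^{Φ,λ}(0)} / ‖f‖_{M^{Φ,λ}(0)} : f ∈ M^{Φ,λ}(0), f ≠ 0} = s_{Φ⁻¹}(a^{n(λ−1)}). -/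
open MeasureTheory Metric Set Filter ENNReal NNReal Topology

noncomputable section

/-- An Orlicz function is an order automorphism of `[0,∞]`. -/
def IsOrliczFn.orderIso {Φ : ℝ≥0∞ → ℝ≥0∞} (hΦ : IsOrliczFn Φ) : ℝ≥0∞ ≃o ℝ≥0∞ :=
  hΦ.strictMono.orderIsoOfSurjective Φ fun v =>
    mem_range_of_exists_le_of_exists_ge hΦ.continuous ⟨0, by simp [hΦ.map_zero]⟩
      ⟨∞, by simp [hΦ.map_top]⟩

theorem IsOrliczFn.orderIso_apply {Φ : ℝ≥0∞ → ℝ≥0∞} (hΦ : IsOrliczFn Φ) (u : ℝ≥0∞) :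
    hΦ.orderIso u = Φ u := rfl

theorem IsOrliczFn.yInv_eq {Φ : ℝ≥0∞ → ℝ≥0∞} (hΦ : IsOrliczFn Φ) (v : ℝ≥0∞) :
    yInv Φ v = hΦ.orderIso.symm v := by
  have hset : {u : ℝ≥0∞ | v < Φ u} = Ioi (hΦ.orderIso.symm v) := by
    ext u
    simp only [mem_ofPred_eq, mem_Ioi, ← hΦ.orderIso_apply]
    exact (OrderIso.symm_apply_lt _).symm
  rw [yInv, hset]
  refine le_antisymm (le_of_forall_gt_imp_ge_of_dense fun u hu => sInf_le hu) ?_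
  exact le_sInf fun u hu => le_of_lt hu

theorem IsOrliczFn.yInv_le_iff {Φ : ℝ≥0∞ → ℝ≥0∞} (hΦ : IsOrliczFn Φ) {u v : ℝ≥0∞} :
    yInv Φ v ≤ u ↔ v ≤ Φ u := by
  rw [hΦ.yInv_eq, OrderIso.symm_apply_le, hΦ.orderIso_apply]

theorem IsOrliczFn.le_yInv_iff {Φ : ℝ≥0∞ → ℝ≥0∞} (hΦ : IsOrliczFn Φ) {u v : ℝ≥0∞} :
    u ≤ yInv Φ v ↔ Φ u ≤ v := by
  rw [hΦ.yInv_eq, OrderIso.le_symm_apply, hΦ.orderIso_apply]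

theorem IsOrliczFn.apply_yInv {Φ : ℝ≥0∞ → ℝ≥0∞} (hΦ : IsOrliczFn Φ) (v : ℝ≥0∞) :
    Φ (yInv Φ v) = v := by
  rw [hΦ.yInv_eq, ← hΦ.orderIso_apply, OrderIso.apply_symm_apply]

theorem IsOrliczFn.yInv_apply {Φ : ℝ≥0∞ → ℝ≥0∞} (hΦ : IsOrliczFn Φ) (u : ℝ≥0∞) :
    yInv Φ (Φ u) = u := by
  rw [hΦ.yInv_eq, ← hΦ.orderIso_apply, OrderIso.symm_apply_apply]

theorem IsOrliczFn.yInv_ne_top {Φ : ℝ≥0∞ → ℝ≥0∞} (hΦ : IsOrliczFn Φ) {v : ℝ≥0∞}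
    (hv : v ≠ ∞) : yInv Φ v ≠ ∞ := fun h => hv <| by
  rw [← hΦ.apply_yInv v, h, hΦ.map_top]

theorem IsOrliczFn.yInv_ne_zero {Φ : ℝ≥0∞ → ℝ≥0∞} (hΦ : IsOrliczFn Φ) {v : ℝ≥0∞}
    (hv : v ≠ 0) : yInv Φ v ≠ 0 := fun h => hv <| by
  rw [← hΦ.apply_yInv v, h, hΦ.map_zero]

theorem IsOrliczFn.mul_apply_le {Φ : ℝ≥0∞ → ℝ≥0∞} (hΦ : IsOrliczFn Φ) {K : ℝ≥0∞}
    (hK : 1 ≤ K) (hK' : K ≠ ∞) (u : ℝ≥0∞) : K * Φ u ≤ Φ (K * u) := by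
  have hK0 : K ≠ 0 := (zero_lt_one.trans_le hK).ne'
  have h := hΦ.convex (K * u) 0 K⁻¹ (ENNReal.inv_le_one.2 hK)
  rw [← mul_assoc, ENNReal.inv_mul_cancel hK0 hK', hΦ.map_zero] at h
  simp only [one_mul, mul_zero, add_zero] at h
  rwa [mul_comm, ← ENNReal.le_div_iff_mul_le (Or.inl hK0) (Or.inl hK'), div_eq_mul_inv, mul_comm]

theorem IsOrliczFn.sDil_ne_top {Φ : ℝ≥0∞ → ℝ≥0∞} (hΦ : IsOrliczFn Φ) {t : ℝ≥0∞}
    (ht : t ≠ ∞) : sDil Φ t ≠ ∞ := by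
  have hK : max 1 t ≠ ∞ := by simp [ht]
  refine ne_top_of_le_ne_top hK (iSup_le fun s => iSup₂_le fun _ _ => ?_)
  refine ENNReal.div_le_of_le_mul (hΦ.yInv_le_iff.2 ?_)
  refine le_trans ?_ (hΦ.mul_apply_le (le_max_left _ _) hK _)
  rw [hΦ.apply_yInv, mul_comm]
  gcongr
  exact le_max_right _ _

theorem yInv_div_le_sDil {Φ : ℝ≥0∞ → ℝ≥0∞} {s : ℝ≥0∞} (hs : s ≠ 0) (hs' : s ≠ ∞) (t : ℝ≥0∞) :
    yInv Φ (s * t) / yInv Φ s ≤ sDil Φ t :=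
  le_iSup₂_of_le s (pos_iff_ne_zero.2 hs) (le_iSup_of_le hs' le_rfl)

theorem IsOrliczFn.sDil_ne_zero {Φ : ℝ≥0∞ → ℝ≥0∞} (hΦ : IsOrliczFn Φ) {t : ℝ≥0∞}
    (ht : t ≠ 0) : sDil Φ t ≠ 0 := by
  refine (lt_of_lt_of_le ?_ (yInv_div_le_sDil one_ne_zero one_ne_top t)).ne'
  rw [one_mul]
  exact ENNReal.div_pos (hΦ.yInv_ne_zero ht) (hΦ.yInv_ne_top one_ne_top)

theorem IsOrliczFn.mul_apply_div_sDil_le {Φ : ℝ≥0∞ → ℝ≥0∞} (hΦ : IsOrliczFn Φ) {t : ℝ≥0∞}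
    (ht : t ≠ 0) (ht' : t ≠ ∞) {u : ℝ≥0∞} (hu : u ≠ ∞) : t * Φ (u / sDil Φ t) ≤ Φ u := by
  have hC := hΦ.sDil_ne_zero ht
  have hC' := hΦ.sDil_ne_top ht'
  have hv : u / sDil Φ t ≠ ∞ := ENNReal.div_ne_top hu hC
  obtain h0 | h0 := eq_or_ne (Φ (u / sDil Φ t)) 0
  · simp [h0]
  have hle := yInv_div_le_sDil (Φ := Φ) h0 (hΦ.finite _ hv) t
  rw [hΦ.yInv_apply] at hle
  have hv0 : u / sDil Φ t ≠ 0 := fun h => h0 (by rw [h, hΦ.map_zero])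
  rw [ENNReal.div_le_iff hv0 hv, ENNReal.mul_div_cancel hC hC', hΦ.yInv_le_iff] at hle
  rwa [mul_comm]

theorem volume_ball_mul {n : ℕ} {a : ℝ} (ha : 0 < a) (r : ℝ) :
    volume (ball (0 : Eu n) (a * r)) = ENNReal.ofReal a ^ n * volume (ball (0 : Eu n) r) := by
  rw [Measure.addHaar_ball_mul_of_pos _ _ ha, finrank_euclideanSpace_fin,
    ENNReal.ofReal_pow ha.le]

theorem volume_ball_ne_zero {n : ℕ} {r : ℝ} (hr : 0 < r) : volume (ball (0 : Eu n) r) ≠ 0 :=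
  (measure_ball_pos _ _ hr).ne'

theorem volume_ball_ne_top {n : ℕ} (r : ℝ) : volume (ball (0 : Eu n) r) ≠ ∞ :=
  measure_ball_lt_top.ne

theorem lintegral_ball_comp_smul {n : ℕ} {a : ℝ} (ha : 0 < a) (r : ℝ) (g : Eu n → ℝ≥0∞) :
    ∫⁻ x in ball 0 (a * r), g x = ENNReal.ofReal a ^ n * ∫⁻ x in ball 0 r, g (a • x) := by
  have hemb : MeasurableEmbedding (fun x : Eu n => a • x) :=
    measurableEmbedding_const_smul₀ ha.ne'
  have hpre : (fun x : Eu n => a • x) ⁻¹' ball 0 (a * r) = ball 0 r := by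
    ext x
    simp [norm_smul, abs_of_pos ha, mul_lt_mul_iff_right₀ ha]
  have hmap := Measure.map_addHaar_smul (volume : Measure (Eu n)) ha.ne'
  rw [← hpre, ← hemb.lintegral_map, ← hemb.restrict_map, hmap, Measure.restrict_smul,
    lintegral_smul_measure, finrank_euclideanSpace_fin, abs_of_pos (by positivity),
    ENNReal.ofReal_inv_of_pos (by positivity), ENNReal.ofReal_pow ha.le, smul_eq_mul,
    ← mul_assoc, ENNReal.mul_inv_cancel (by simp [ha]) (by finiteness), one_mul]

theorem ofReal_rpow_dim {a : ℝ} (ha : 0 < a) (n : ℕ) (e : ℝ) :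
    ENNReal.ofReal (a ^ ((n : ℝ) * e)) = (ENNReal.ofReal a ^ n) ^ e := by
  rw [← ENNReal.ofReal_rpow_of_pos ha, ENNReal.rpow_mul, ENNReal.rpow_natCast]

/-- The modular of a dilated function, in terms of that of the function itself. -/
theorem modular_comp_smul {n : ℕ} {a : ℝ} (ha : 0 < a) (lam : ℝ) {r : ℝ}
    (g : Eu n → ℝ≥0∞) :
    volume (ball (0 : Eu n) r) ^ (-lam) * ∫⁻ x in ball 0 r, g (a • x) =
      ENNReal.ofReal (a ^ ((n : ℝ) * (lam - 1))) *
        (volume (ball (0 : Eu n) (a * r)) ^ (-lam) * ∫⁻ x in ball 0 (a * r), g x) := by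
  have h0 : ENNReal.ofReal a ^ n ≠ 0 := by simp [ha]
  have ht : ENNReal.ofReal a ^ n ≠ ∞ := by finiteness
  rw [lintegral_ball_comp_smul ha, volume_ball_mul ha, ofReal_rpow_dim ha,
    ENNReal.mul_rpow_of_ne_top ht (volume_ball_ne_top r)]
  have hc : (ENNReal.ofReal a ^ n) ^ (lam - 1) *
      ((ENNReal.ofReal a ^ n) ^ (-lam) * ENNReal.ofReal a ^ n) = 1 := by
    nth_rewrite 3 [← ENNReal.rpow_one (ENNReal.ofReal a ^ n)]
    rw [← ENNReal.rpow_add _ _ h0 ht, ← ENNReal.rpow_add _ _ h0 ht]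
    simp
  generalize volume (ball (0 : Eu n) r) ^ (-lam) = V
  generalize ∫⁻ x in ball (0 : Eu n) r, g (a • x) = I
  calc V * I = 1 * (V * I) := (one_mul _).symm
    _ = _ := by rw [← hc]; ring

theorem IsOrliczFn.orliczNorm_comp_smul_le {n : ℕ} {Φ : ℝ≥0∞ → ℝ≥0∞} (hΦ : IsOrliczFn Φ)
    (lam : ℝ) {a : ℝ} (ha : 0 < a) (f : Eu n → ℝ) (r : ℝ) :
    orliczNorm Φ lam (ball 0 r) (fun x => f (a • x)) ≤
      sDil Φ (ENNReal.ofReal (a ^ ((n : ℝ) * (lam - 1)))) *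
        orliczNorm Φ lam (ball 0 (a * r)) f := by
  set t := ENNReal.ofReal (a ^ ((n : ℝ) * (lam - 1))) with htdef
  have ht : t ≠ 0 := by simp only [htdef, ne_eq, ENNReal.ofReal_eq_zero, not_le]; positivity
  have ht' : t ≠ ∞ := ENNReal.ofReal_ne_top
  have hC := hΦ.sDil_ne_zero ht
  have hC' := hΦ.sDil_ne_top ht'
  rw [mul_comm, ← ENNReal.div_le_iff hC hC']
  refine le_sInf fun ε ⟨hε, hε', hle⟩ => ?_
  rw [ENNReal.div_le_iff hC hC']
  refine sInf_le ⟨ENNReal.mul_pos hε.ne' hC, ENNReal.mul_ne_top hε' hC', ?_⟩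
  rw [modular_comp_smul ha lam (fun y => Φ ((‖f y‖₊ : ℝ≥0∞) / (ε * sDil Φ t))), ← htdef,
    mul_left_comm, ← lintegral_const_mul' _ _ ht']
  refine le_trans ?_ hle
  gcongr with x
  rw [div_eq_mul_inv, ENNReal.mul_inv (Or.inl hε.ne') (Or.inl hε'), ← mul_assoc,
    ← div_eq_mul_inv, ← div_eq_mul_inv]
  exact hΦ.mul_apply_div_sDil_le ht ht' (ENNReal.div_ne_top ENNReal.coe_ne_top hε.ne')

theorem IsOrliczFn.centralNorm_comp_smul_le {n : ℕ} {Φ : ℝ≥0∞ → ℝ≥0∞} (hΦ : IsOrliczFn Φ)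
    (lam : ℝ) {a : ℝ} (ha : 0 < a) (f : Eu n → ℝ) :
    centralNorm Φ lam (fun x => f (a • x)) ≤
      sDil Φ (ENNReal.ofReal (a ^ ((n : ℝ) * (lam - 1)))) * centralNorm Φ lam f := by
  refine iSup₂_le fun r hr => (hΦ.orliczNorm_comp_smul_le lam ha f r).trans ?_
  gcongr
  exact le_iSup₂_of_le (a * r) (mul_pos ha hr) le_rfl

/-- The modular of the indicator of a centred ball on another centred ball. -/
theorem IsOrliczFn.lintegral_indicator_ball {n : ℕ} {Φ : ℝ≥0∞ → ℝ≥0∞} (hΦ : IsOrliczFn Φ)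
    (r R : ℝ) (ε : ℝ≥0∞) :
    ∫⁻ x in ball (0 : Eu n) r, Φ ((‖(ball (0 : Eu n) R).indicator (1 : Eu n → ℝ) x‖₊ : ℝ≥0∞) / ε) =
      Φ ε⁻¹ * volume (ball (0 : Eu n) (min r R)) := by
  have h : (fun x : Eu n => Φ ((‖(ball (0 : Eu n) R).indicator (1 : Eu n → ℝ) x‖₊ : ℝ≥0∞) / ε)) =
      (ball (0 : Eu n) R).indicator fun _ => Φ ε⁻¹ := by
    ext x
    by_cases hx : x ∈ ball (0 : Eu n) R
    · simp only [indicator_of_mem hx, Pi.one_apply, nnnorm_one, ENNReal.coe_one, one_div]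
    · simp only [indicator_of_notMem hx, nnnorm_zero, ENNReal.coe_zero, ENNReal.zero_div,
        hΦ.map_zero]
  rw [h, lintegral_indicator_const measurableSet_ball, Measure.restrict_apply measurableSet_ball]
  congr 2
  ext x
  simp [and_comm]

theorem IsOrliczFn.centralNorm_indicator_ball {n : ℕ} {Φ : ℝ≥0∞ → ℝ≥0∞} (hΦ : IsOrliczFn Φ)
    {lam : ℝ} (hlam0 : 0 ≤ lam) (hlam1 : lam ≤ 1) {R : ℝ} (hR : 0 < R) :
    centralNorm Φ lam ((ball (0 : Eu n) R).indicator 1) =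
      (yInv Φ (volume (ball (0 : Eu n) R) ^ (lam - 1)))⁻¹ := by
  have hpow {r : ℝ} (hr : 0 < r) : volume (ball (0 : Eu n) r) ^ (-lam) *
      volume (ball (0 : Eu n) r) = volume (ball (0 : Eu n) r) ^ (1 - lam) := by
    nth_rewrite 2 [← ENNReal.rpow_one (volume (ball (0 : Eu n) r))]
    rw [← ENNReal.rpow_add _ _ (volume_ball_ne_zero hr) (volume_ball_ne_top r), neg_add_eq_sub]
  have hinv (v : ℝ≥0∞) : v ^ (lam - 1) = (v ^ (1 - lam))⁻¹ := by
    rw [← ENNReal.rpow_neg, neg_sub]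
  set V := volume (ball (0 : Eu n) R) with hV
  have hV0 : V ^ (lam - 1) ≠ 0 := by
    simp [ENNReal.rpow_eq_zero_iff, hV, volume_ball_ne_zero hR, volume_ball_ne_top]
  have hVt : V ^ (lam - 1) ≠ ∞ := by
    simp [ENNReal.rpow_eq_top_iff, hV, volume_ball_ne_zero hR, volume_ball_ne_top]
  apply le_antisymm
  · refine iSup₂_le fun r hr => sInf_le ⟨?_, ?_, ?_⟩
    · exact ENNReal.inv_pos.2 (hΦ.yInv_ne_top hVt)
    · exact ENNReal.inv_ne_top.2 (hΦ.yInv_ne_zero hV0)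
    · rw [hΦ.lintegral_indicator_ball, inv_inv, hΦ.apply_yInv, mul_left_comm, hinv,
        mul_comm, ← div_eq_mul_inv]
      refine ENNReal.div_le_of_le_mul ?_
      rw [one_mul]
      obtain h | h := le_total r R
      · rw [min_eq_left h, hpow hr]
        exact ENNReal.rpow_le_rpow (measure_mono (ball_subset_ball h)) (by linarith)
      · rw [min_eq_right h, ← hpow hR]
        gcongr ?_ * _
        rw [ENNReal.rpow_neg, ENNReal.rpow_neg, ENNReal.inv_le_inv]
        exact ENNReal.rpow_le_rpow (measure_mono (ball_subset_ball h)) hlam0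
  · refine le_iSup₂_of_le R hR (le_sInf fun ε ⟨_, _, hle⟩ => ?_)
    rw [hΦ.lintegral_indicator_ball, min_self, mul_left_comm, hpow hR,
      ← ENNReal.le_inv_iff_mul_le, ← hinv, ← hΦ.le_yInv_iff] at hle
    exact ENNReal.inv_le_iff_inv_le.1 hle

theorem indicator_ball_comp_smul {n : ℕ} {a : ℝ} (ha : 0 < a) (r : ℝ) :
    (fun x : Eu n => (ball (0 : Eu n) (a * r)).indicator (1 : Eu n → ℝ) (a • x)) =
      (ball (0 : Eu n) r).indicator 1 := by
  funext x
  simp [Set.indicator, norm_smul, abs_of_pos ha, mul_lt_mul_iff_right₀ ha]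

theorem exists_volume_ball_rpow_eq {n : ℕ} {e : ℝ} (he : (n : ℝ) * e ≠ 0) {s : ℝ≥0∞}
    (hs : s ≠ 0) (hs' : s ≠ ∞) : ∃ r > 0, volume (ball (0 : Eu n) r) ^ e = s := by
  have he0 : e ≠ 0 := right_ne_zero_of_mul he
  have hn : n ≠ 0 := by exact_mod_cast left_ne_zero_of_mul he
  have hV0 := volume_ball_ne_zero (n := n) one_pos
  have hVt := volume_ball_ne_top (n := n) 1
  set V := volume (ball (0 : Eu n) 1) with hV
  have hq0 : s ^ e⁻¹ / V ≠ 0 := by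
    simp [ENNReal.div_eq_zero_iff, ENNReal.rpow_eq_zero_iff, hs, hs', hVt]
  have hqt : s ^ e⁻¹ / V ≠ ∞ := by
    simp [ENNReal.div_eq_top, ENNReal.rpow_eq_top_iff, hs, hs', hV0]
  have hpos := ENNReal.toReal_pos hq0 hqt
  have hρ : 0 < (s ^ e⁻¹ / V).toReal ^ (n : ℝ)⁻¹ := by positivity
  refine ⟨_, hρ, ?_⟩
  rw [← mul_one (_ ^ (n : ℝ)⁻¹), volume_ball_mul hρ, ← ENNReal.ofReal_pow hρ.le,
    Real.rpow_inv_natCast_pow hpos.le hn, ENNReal.ofReal_toReal hqt, ← hV,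
    ENNReal.div_mul_cancel hV0 hVt, ENNReal.rpow_inv_rpow he0]

/-- norm of the dilation operator on central Morrey–Orlicz spaces. -/
theorem statement6 {n : ℕ} (Φ : ℝ≥0∞ → ℝ≥0∞) (hΦ : IsOrliczFn Φ) (lam : ℝ)
    (hlam0 : 0 ≤ lam) (hlam1 : lam ≤ 1) (a : ℝ) (ha : 0 < a) :
    (∀ f : Eu n → ℝ, LocallyIntegrable f volume → centralNorm Φ lam f ≠ ∞ →
      centralNorm Φ lam (fun x => f (a • x)) ≤
        sDil Φ (ENNReal.ofReal (a ^ ((n : ℝ) * (lam - 1)))) * centralNorm Φ lam f) ∧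
    (⨆ (f : Eu n → ℝ) (_ : LocallyIntegrable f volume) (_ : centralNorm Φ lam f ≠ ∞)
        (_ : centralNorm Φ lam f ≠ 0),
      centralNorm Φ lam (fun x => f (a • x)) / centralNorm Φ lam f) =
        sDil Φ (ENNReal.ofReal (a ^ ((n : ℝ) * (lam - 1)))) := by
  refine ⟨fun f _ _ => hΦ.centralNorm_comp_smul_le lam ha f, le_antisymm ?_ ?_⟩
  · refine iSup₂_le fun f _ => iSup₂_le fun _ _ => ENNReal.div_le_of_le_mul ?_
    exact hΦ.centralNorm_comp_smul_le lam ha f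
  refine iSup_le fun s => iSup₂_le fun hs hs' => ?_
  obtain ⟨r, hr, hratio⟩ : ∃ r > 0,
      yInv Φ (s * ENNReal.ofReal (a ^ ((n : ℝ) * (lam - 1)))) / yInv Φ s =
        yInv Φ (volume (ball (0 : Eu n) (a * r)) ^ (lam - 1)) /
          yInv Φ (volume (ball (0 : Eu n) r) ^ (lam - 1)) := by
    have hmul (r : ℝ) : volume (ball (0 : Eu n) (a * r)) ^ (lam - 1) =
        volume (ball (0 : Eu n) r) ^ (lam - 1) *
          ENNReal.ofReal (a ^ ((n : ℝ) * (lam - 1))) := by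
      rw [volume_ball_mul ha, ofReal_rpow_dim ha,
        ENNReal.mul_rpow_of_ne_top (by finiteness) (volume_ball_ne_top r), mul_comm]
    obtain he | he := eq_or_ne ((n : ℝ) * (lam - 1)) 0
    · refine ⟨1, one_pos, ?_⟩
      rw [hmul, he, Real.rpow_zero, ENNReal.ofReal_one, mul_one, mul_one,
        ENNReal.div_self (hΦ.yInv_ne_zero hs.ne') (hΦ.yInv_ne_top hs'), ENNReal.div_self]
      · apply hΦ.yInv_ne_zero
        simp [ENNReal.rpow_eq_zero_iff, volume_ball_ne_zero, volume_ball_ne_top]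
      · apply hΦ.yInv_ne_top
        simp [ENNReal.rpow_eq_top_iff, volume_ball_ne_zero, volume_ball_ne_top]
    · obtain ⟨r, hr, h⟩ := exists_volume_ball_rpow_eq he hs.ne' hs'
      exact ⟨r, hr, by rw [hmul, h]⟩
  have har := mul_pos ha hr
  have hnorm := hΦ.centralNorm_indicator_ball (n := n) hlam0 hlam1 har
  rw [hratio]
  refine le_iSup₂_of_le ((ball (0 : Eu n) (a * r)).indicator 1) ?_
    (le_iSup₂_of_le ?_ ?_ ?_)
  · exact (locallyIntegrable_const (1 : ℝ)).indicator measurableSet_ball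
  · rw [hnorm]
    refine ENNReal.inv_ne_top.2 (hΦ.yInv_ne_zero ?_)
    simp [ENNReal.rpow_eq_zero_iff, volume_ball_ne_zero har, volume_ball_ne_top]
  · rw [hnorm]
    refine ENNReal.inv_ne_zero.2 (hΦ.yInv_ne_top ?_)
    simp [ENNReal.rpow_eq_top_iff, volume_ball_ne_zero har, volume_ball_ne_top]
  · rw [indicator_ball_comp_smul ha, hnorm, hΦ.centralNorm_indicator_ball hlam0 hlam1 hr,
      div_eq_mul_inv, div_eq_mul_inv, inv_inv, mul_comm]
end
end

section
/- Let 0 < α < n, let Φ, Ψ be Orlicz functions, and let 0 ≤ λ < 1, 0 < μ < 1. If there exists a constant c > 0 with c ≤ v_n^{λ/μ} / v_{n−1} (where v₀ = 1) such that liminf_{t→∞} Φ⁻¹(c t^λ) / Ψ⁻¹(t^μ) = ∞, then the Riesz potential I_α is not bounded from M^{Φ,λ}(0) to M^{Ψ,μ}(0); in fact, for the functions f_R = χ_{B(x_R,1)} with x_R = (R,0,…,0) and R ≥ 1 one has liminf_{R→∞} ‖I_α f_R‖_{M^{Ψ,μ}(0)} / ‖f_R‖_{M^{Φ,λ}(0)}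 = ∞. -/
open MeasureTheory Metric Set Filter ENNReal NNReal Topology

noncomputable section

theorem IsOrliczFn.mul_yInv_le {Φ : ℝ≥0∞ → ℝ≥0∞} (hΦ : IsOrliczFn Φ) {k : ℝ≥0∞}
    (hk : k ≤ 1) (w : ℝ≥0∞) : k * yInv Φ w ≤ yInv Φ (k * w) := by
  rcases eq_or_ne k 0 with rfl | hk0
  · simp
  have hkt : k ≠ ∞ := (hk.trans_lt one_lt_top).ne
  refine le_sInf fun u (hu : k * w < Φ u) => ?_
  have hku : k * (u / k) = u := ENNReal.mul_div_cancel hk0 hkt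
  have hconv := hΦ.convex (u / k) 0 k hk
  simp only [hΦ.map_zero, mul_zero, add_zero, hku] at hconv
  have hw : w < Φ (u / k) := lt_of_mul_lt_mul_left' (hu.trans_le hconv)
  calc k * yInv Φ w ≤ k * (u / k) := by gcongr; exact sInf_le hw
    _ = u := hku

theorem IsOrliczFn.ofReal_min_mul_yInv_le {Φ : ℝ≥0∞ → ℝ≥0∞} (hΦ : IsOrliczFn Φ) (k : ℝ)
    (w : ℝ≥0∞) : ENNReal.ofReal (min 1 k) * yInv Φ w ≤ yInv Φ (ENNReal.ofReal k * w) :=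
  (hΦ.mul_yInv_le (by simp) w).trans
    (yInv_mono Φ (by gcongr; exact min_le_right _ _))

theorem volume_unit_ball_pos (n : ℕ) : 0 < (volume (ball (0 : Eu n) 1)).toReal :=
  ENNReal.toReal_pos (measure_ball_pos _ _ one_pos).ne' measure_ball_lt_top.ne

theorem volume_ball_rpow_div {n : ℕ} {a R : ℝ} (ha : 0 < a) (hR : 0 < R) (p : ℝ) :
    volume (ball (0 : Eu n) (a * R)) ^ p / volume (ball (0 : Eu n) 1) =
      ENNReal.ofReal ((a ^ n * (volume (ball (0 : Eu n) 1)).toReal) ^ p /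
        (volume (ball (0 : Eu n) 1)).toReal * (R ^ n) ^ p) := by
  have hv := volume_unit_ball_pos n
  have hvt : volume (ball (0 : Eu n) 1) =
      ENNReal.ofReal (volume (ball (0 : Eu n) 1)).toReal :=
    (ENNReal.ofReal_toReal measure_ball_lt_top.ne).symm
  rw [Measure.addHaar_ball_of_pos volume (0 : Eu n) (mul_pos ha hR)]
  set v := (volume (ball (0 : Eu n) 1)).toReal
  rw [hvt, ← ENNReal.ofReal_mul (by positivity), ENNReal.ofReal_rpow_of_pos (by positivity),
    ← ENNReal.ofReal_div_of_pos hv, finrank_euclideanSpace_fin,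
    show (a * R) ^ n * v = (a ^ n * v) * R ^ n by ring,
    Real.mul_rpow (by positivity) (by positivity)]
  congr 1
  ring

theorem integrable_indicator_ball_div_norm_rpow {n : ℕ} (hn : 0 < n) {β : ℝ}
    (hβn : β < n) {x z : Eu n} (hx : x ∈ ball z 1) :
    Integrable fun y : Eu n => (ball z 1).indicator (1 : Eu n → ℝ) y / ‖x - y‖ ^ β := by
  have hg : LocallyIntegrable (fun y : Eu n => ‖y‖ ^ (-β)) := by
    refine locallyIntegrable_of_norm_le_rpow (C := 1) (α := β)
      (by rw [finrank_euclideanSpace_fin]; omega)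
      (by rw [finrank_euclideanSpace_fin]; exact hβn) (ae_of_all _ fun y => ?_) ?_
    · rw [one_mul, Real.norm_of_nonneg (by positivity)]
    · exact (measurable_norm.pow_const _).aestronglyMeasurable
  have h2 : Integrable ((ball (0 : Eu n) 2).indicator fun y : Eu n => ‖y‖ ^ (-β)) :=
    ((hg.integrableOn_isCompact (isCompact_closedBall 0 2)).mono_set
      ball_subset_closedBall).integrable_indicator measurableSet_ball
  have h3 := (h2.comp_sub_left x).indicator (measurableSet_ball (x := z) (ε := 1))
  refine h3.congr (ae_of_all _ fun y => ?_)
  by_cases hy : y ∈ ball z 1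
  · have hxy : x - y ∈ ball (0 : Eu n) 2 := by
      rw [mem_ball_zero_iff, ← dist_eq_norm]
      have := dist_triangle_right x y z
      rw [mem_ball] at hx hy
      linarith
    simp only [indicator_of_mem hy, indicator_of_mem hxy, Pi.one_apply]
    rw [Real.rpow_neg (norm_nonneg _), one_div]
  · simp [indicator_of_notMem hy]

theorem le_riesz_indicator_ball {n : ℕ} (hn : 0 < n) {α : ℝ} (hα : 0 < α) (hαn : α < n)
    {x z : Eu n} (hx : x ∈ ball z 1) :
    (volume (ball (0 : Eu n) 1)).toReal / 2 ^ ((n : ℝ) - α) ≤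
      riesz α ((ball z 1).indicator 1) x := by
  have hvol : (volume (ball (0 : Eu n) 1)).toReal = volume.real (ball z 1) := by
    rw [Measure.real, Measure.addHaar_ball_center volume z 1]
  have : Nontrivial (Eu n) :=
    Module.nontrivial_of_finrank_pos (R := ℝ) (by rw [finrank_euclideanSpace_fin]; exact hn)
  have hconst : ∫ y : Eu n, (ball z 1).indicator (fun _ => ((2 : ℝ) ^ ((n : ℝ) - α))⁻¹) y =
      (volume (ball (0 : Eu n) 1)).toReal / 2 ^ ((n : ℝ) - α) := by
    rw [integral_indicator_const _ measurableSet_ball, hvol, smul_eq_mul, div_eq_mul_inv]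
  rw [← hconst]
  refine integral_mono_ae ?_ (integrable_indicator_ball_div_norm_rpow hn (by linarith) hx) ?_
  · exact (integrableOn_const measure_ball_lt_top.ne).integrable_indicator measurableSet_ball
  · filter_upwards [measure_eq_zero_iff_ae_notMem.1 (measure_singleton (μ := volume) x)] with y hyx
    by_cases hy : y ∈ ball z 1
    · have hpos : 0 < ‖x - y‖ := by
        rw [norm_pos_iff, sub_ne_zero]
        rintro rfl
        exact hyx rfl
      have hle : ‖x - y‖ ≤ 2 := by
        rw [← dist_eq_norm]
        have := dist_triangle_right x y z
        rw [mem_ball] at hx hy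
        linarith
      simp only [indicator_of_mem hy, Pi.one_apply, one_div]
      have : 0 ≤ (n : ℝ) - α := by linarith
      gcongr
    · simp [indicator_of_notMem hy]

theorem centralNorm_indicator_ball_le {n : ℕ} {Φ : ℝ≥0∞ → ℝ≥0∞} (hΦ : IsOrliczFn Φ)
    {lam : ℝ} (hlam : 0 ≤ lam) {z : Eu n} (hz : 2 ≤ ‖z‖) :
    centralNorm Φ lam ((ball z 1).indicator 1) ≤
      (yInv Φ (volume (ball (0 : Eu n) (2⁻¹ * ‖z‖)) ^ lam / volume (ball (0 : Eu n) 1)))⁻¹ := by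
  set V := volume (ball (0 : Eu n) (2⁻¹ * ‖z‖))
  set v := volume (ball (0 : Eu n) 1) with hv
  have hV0 : V ≠ 0 := (measure_ball_pos _ _ (by positivity)).ne'
  have hVt : V ≠ ∞ := measure_ball_lt_top.ne
  have hv0 : v ≠ 0 := (measure_ball_pos _ _ one_pos).ne'
  have hvt : v ≠ ∞ := measure_ball_lt_top.ne
  refine iSup₂_le fun r _ => le_of_forall_gt_imp_ge_of_dense fun ε hε => ?_
  rcases eq_or_ne ε ∞ with rfl | hεt
  · exact le_top
  refine sInf_le ⟨(zero_le).trans_lt hε, hεt, ?_⟩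
  have hΦε : Φ ε⁻¹ ≤ V ^ lam / v := by
    by_contra! h
    exact absurd (sInf_le h : yInv Φ _ ≤ ε⁻¹) (not_le.2 (ENNReal.inv_lt_iff_inv_lt.1 hε))
  have hf : ∀ x, Φ ((‖(ball z 1).indicator (1 : Eu n → ℝ) x‖₊ : ℝ≥0∞) / ε) =
      (ball z 1).indicator (fun _ => Φ ε⁻¹) x := by
    intro x
    by_cases hx : x ∈ ball z 1
    · simp [indicator_of_mem hx]
    · simp [indicator_of_notMem hx, hΦ.map_zero]
  simp only [hf]
  rw [lintegral_indicator_const measurableSet_ball, Measure.restrict_apply measurableSet_ball]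
  rcases le_or_gt r (2⁻¹ * ‖z‖) with hr | hr
  · have hempty : ball z 1 ∩ ball 0 r = ∅ := by
      refine (ball_disjoint_ball ?_).inter_eq
      rw [dist_zero_right]
      linarith
    simp [hempty]
  · calc volume (ball (0 : Eu n) r) ^ (-lam) * (Φ ε⁻¹ * volume (ball z 1 ∩ ball 0 r))
        ≤ V ^ (-lam) * (V ^ lam / v * v) := by
          have h1 : volume (ball (0 : Eu n) r) ^ (-lam) ≤ V ^ (-lam) := by
            rw [ENNReal.rpow_neg, ENNReal.rpow_neg, ENNReal.inv_le_inv]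
            exact ENNReal.rpow_le_rpow (measure_mono (ball_subset_ball hr.le)) hlam
          have h2 : volume (ball z 1 ∩ ball 0 r) ≤ v :=
            (measure_mono inter_subset_left).trans
              (Measure.addHaar_ball_center volume z 1).le
          gcongr
      _ = 1 := by
          rw [ENNReal.div_mul_cancel hv0 hvt, ← ENNReal.rpow_add _ _ hV0 hVt]
          simp

theorem le_centralNorm_of_le_on_ball {n : ℕ} {Ψ : ℝ≥0∞ → ℝ≥0∞} (hΨ : IsOrliczFn Ψ)
    {mu : ℝ} {z : Eu n} (hz : 1 ≤ ‖z‖) {g : Eu n → ℝ} {K : ℝ}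
    (hg : ∀ x ∈ ball z 1, K ≤ g x) :
    ENNReal.ofReal K /
      yInv Ψ (volume (ball (0 : Eu n) (2 * ‖z‖)) ^ mu / volume (ball (0 : Eu n) 1)) ≤
      centralNorm Ψ mu g := by
  refine le_trans ?_ (le_iSup₂ (f := fun (r : ℝ) (_ : 0 < r) =>
    orliczNorm Ψ mu (ball (0 : Eu n) r) g) (2 * ‖z‖) (by positivity))
  set V := volume (ball (0 : Eu n) (2 * ‖z‖))
  set v := volume (ball (0 : Eu n) 1) with hv
  have hV0 : V ≠ 0 := (measure_ball_pos _ _ (by positivity)).ne'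
  have hVt : V ≠ ∞ := measure_ball_lt_top.ne
  have hv0 : v ≠ 0 := (measure_ball_pos _ _ one_pos).ne'
  have hvt : v ≠ ∞ := measure_ball_lt_top.ne
  refine le_sInf fun ε ⟨hε0, hεt, hε⟩ => ?_
  have hsub : ball z 1 ⊆ ball 0 (2 * ‖z‖) :=
    ball_subset_ball' (by rw [dist_zero_right]; linarith)
  have hint : Ψ (ENNReal.ofReal K / ε) * v ≤
      ∫⁻ x in ball (0 : Eu n) (2 * ‖z‖), Ψ ((‖g x‖₊ : ℝ≥0∞) / ε) := by
    calc Ψ (ENNReal.ofReal K / ε) * v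
        = ∫⁻ _ in ball z 1, Ψ (ENNReal.ofReal K / ε) := by
          rw [setLIntegral_const, hv, Measure.addHaar_ball_center volume z 1]
      _ ≤ ∫⁻ x in ball z 1, Ψ ((‖g x‖₊ : ℝ≥0∞) / ε) := by
          refine setLIntegral_mono' measurableSet_ball fun x hx => hΨ.strictMono.monotone ?_
          gcongr
          rw [← enorm_eq_nnnorm, ← ofReal_norm]
          exact ENNReal.ofReal_le_ofReal ((hg x hx).trans (le_abs_self _))
      _ ≤ _ := lintegral_mono_set hsub
  have hΨε : Ψ (ENNReal.ofReal K / ε) ≤ V ^ mu / v := by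
    rw [ENNReal.le_div_iff_mul_le (Or.inl hv0) (Or.inl hvt)]
    refine hint.trans ?_
    rw [ENNReal.rpow_neg, mul_comm, ← div_eq_mul_inv] at hε
    simpa using (ENNReal.div_le_iff (ENNReal.rpow_pos hV0.bot_lt hVt).ne'
      (ENNReal.rpow_ne_top_of_ne_zero hV0 hVt)).1 hε
  have hle : ENNReal.ofReal K / ε ≤ yInv Ψ (V ^ mu / v) :=
    le_sInf fun u hu => (hΨ.strictMono.lt_iff_lt.1 (hΨε.trans_lt hu)).le
  rw [ENNReal.div_le_iff hε0.ne' hεt] at hle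
  exact ENNReal.div_le_of_le_mul' hle

/-- unboundedness of the Riesz potential under the liminf condition. -/
theorem statement9 {n : ℕ} (hn : 0 < n) (α : ℝ) (hα : 0 < α) (hαn : α < n)
    (Φ Ψ : ℝ≥0∞ → ℝ≥0∞) (hΦ : IsOrliczFn Φ) (hΨ : IsOrliczFn Ψ) (lam mu : ℝ)
    (hlam0 : 0 ≤ lam) (hlam1 : lam < 1) (hmu0 : 0 < mu) (hmu1 : mu < 1)
    (c : ℝ) (hc : 0 < c)
    (hcle : ENNReal.ofReal c ≤
      volume (ball (0 : Eu n) 1) ^ (lam / mu) / volume (ball (0 : Eu (n - 1)) 1))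
    (hlim : Filter.liminf
      (fun t : ℝ => yInv Φ (ENNReal.ofReal (c * t ^ lam)) / yInv Ψ (ENNReal.ofReal (t ^ mu)))
      Filter.atTop = ∞) :
    (¬ ∃ C : ℝ, 0 < C ∧ ∀ f : Eu n → ℝ, LocallyIntegrable f volume → centralNorm Φ lam f ≠ ∞ →
      centralNorm Ψ mu (riesz α f) ≤ ENNReal.ofReal C * centralNorm Φ lam f) ∧
    Filter.liminf
      (fun R : ℝ =>
        centralNorm Ψ mu (riesz α ((ball (EuclideanSpace.single (⟨0, hn⟩ : Fin n) R) 1).indicator 1)) /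
          centralNorm Φ lam ((ball (EuclideanSpace.single (⟨0, hn⟩ : Fin n) R) 1).indicator 1))
      Filter.atTop = ∞ := by
  set N : ℝ → ℝ≥0∞ := fun R => centralNorm Ψ mu
    (riesz α ((ball (EuclideanSpace.single (⟨0, hn⟩ : Fin n) R) 1).indicator 1))
  set D : ℝ → ℝ≥0∞ := fun R => centralNorm Φ lam
    ((ball (EuclideanSpace.single (⟨0, hn⟩ : Fin n) R) 1).indicator 1)
  set g : ℝ → ℝ≥0∞ := fun t =>
    yInv Φ (ENNReal.ofReal (c * t ^ lam)) / yInv Ψ (ENNReal.ofReal (t ^ mu)) with hg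
  set v := (volume (ball (0 : Eu n) 1)).toReal with hv
  have hv0 : 0 < v := volume_unit_ball_pos n
  have hgt : Tendsto (fun R : ℝ => g (R ^ n)) atTop (𝓝 ∞) :=
    (tendsto_of_le_liminf_of_limsup_le hlim.ge le_top).comp (tendsto_pow_atTop hn.ne')
  set K := v / 2 ^ ((n : ℝ) - α) with hK
  have hK0 : 0 < K := by positivity
  set a := ((2⁻¹ : ℝ) ^ n * v) ^ lam / v / c with ha
  have ha0 : 0 < a := by positivity
  set b := ((2 : ℝ) ^ n * v) ^ mu / v with hb
  have hb0 : 0 < b := by positivity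
  set k₁ := ENNReal.ofReal (min 1 a) with hk₁
  set k₂ := ENNReal.ofReal (min 1 b⁻¹) with hk₂
  have hk₁0 : k₁ ≠ 0 := by simp [hk₁, ha0]
  have hk₂0 : k₂ ≠ 0 := by simp [hk₂, hb0]
  have hk₂t : k₂ ≠ ∞ := ENNReal.ofReal_ne_top
  set κ := ENNReal.ofReal K * k₂ * k₁ with hκ
  have hκ0 : κ ≠ 0 := mul_ne_zero (mul_ne_zero (by simp [hK0]) hk₂0) hk₁0
  have hnorm : ∀ R : ℝ, 2 ≤ R → ‖(EuclideanSpace.single (⟨0, hn⟩ : Fin n) R : Eu n)‖ = R := by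
    intro R hR
    rw [PiLp.norm_single, Real.norm_of_nonneg (by linarith)]
  have hDle : ∀ R : ℝ, 2 ≤ R →
      D R ≤ (k₁ * yInv Φ (ENNReal.ofReal (c * (R ^ n) ^ lam)))⁻¹ := by
    intro R hR
    refine (centralNorm_indicator_ball_le hΦ hlam0 (by rw [hnorm R hR]; exact hR)).trans ?_
    rw [hnorm R hR, volume_ball_rpow_div (by norm_num) (by linarith), ENNReal.inv_le_inv]
    refine (hΦ.ofReal_min_mul_yInv_le a _).trans_eq ?_
    rw [← ENNReal.ofReal_mul ha0.le]
    congr 2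
    rw [ha, ← hv]
    field_simp
  have hNge : ∀ R : ℝ, 2 ≤ R →
      ENNReal.ofReal K * k₂ / yInv Ψ (ENNReal.ofReal ((R ^ n) ^ mu)) ≤ N R := by
    intro R hR
    refine le_trans ?_ (le_centralNorm_of_le_on_ball hΨ (by rw [hnorm R hR]; linarith)
      fun x hx => le_riesz_indicator_ball hn hα hαn hx)
    rw [hnorm R hR, volume_ball_rpow_div (by norm_num) (by linarith), ← hv, ← hK, ← hb]
    have h := hΨ.ofReal_min_mul_yInv_le b⁻¹ (ENNReal.ofReal (b * (R ^ n) ^ mu))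
    rw [← ENNReal.ofReal_mul (inv_nonneg.2 hb0.le), inv_mul_cancel_left₀ hb0.ne', ← hk₂] at h
    calc ENNReal.ofReal K * k₂ / yInv Ψ (ENNReal.ofReal ((R ^ n) ^ mu))
        ≤ ENNReal.ofReal K * k₂ / (k₂ * yInv Ψ (ENNReal.ofReal (b * (R ^ n) ^ mu))) := by
          gcongr
      _ = _ := by
          rw [mul_comm (ENNReal.ofReal K) k₂, ENNReal.mul_div_mul_left _ _ hk₂0 hk₂t]
  have hratio : ∀ R : ℝ, 2 ≤ R → κ * g (R ^ n) ≤ N R / D R := by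
    intro R hR
    refine le_trans (le_of_eq ?_) (ENNReal.div_le_div (hNge R hR) (hDle R hR))
    simp only [hκ, hg, div_eq_mul_inv, inv_inv]
    ring
  have hlimκ : Tendsto (fun R : ℝ => κ * g (R ^ n)) atTop (𝓝 ∞) := by
    simpa [ENNReal.mul_top hκ0] using ENNReal.Tendsto.const_mul (a := κ) hgt (Or.inl top_ne_zero)
  have hlimND : Tendsto (fun R => N R / D R) atTop (𝓝 ∞) :=
    tendsto_nhds_top_mono hlimκ ((eventually_ge_atTop 2).mono hratio)
  refine ⟨?_, hlimND.liminf_eq⟩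
  rintro ⟨C, -, hC⟩
  obtain ⟨R, hRC, hRg, hR⟩ := ((hlimND.eventually_const_lt
    (ENNReal.ofReal_lt_top (r := C))).and ((hgt.eventually_const_lt
      ENNReal.zero_lt_top).and (eventually_ge_atTop 2))).exists
  have hQ : yInv Φ (ENNReal.ofReal (c * (R ^ n) ^ lam)) ≠ 0 := by
    intro h
    simp [hg, h] at hRg
  have hDt : D R ≠ ∞ :=
    ((hDle R hR).trans_lt (ENNReal.inv_lt_top.2 (mul_ne_zero hk₁0 hQ).bot_lt)).ne
  have hint : LocallyIntegrable
      ((ball (EuclideanSpace.single (⟨0, hn⟩ : Fin n) R) 1).indicator (1 : Eu n → ℝ)) volume :=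
    (locallyIntegrable_const (1 : ℝ)).indicator measurableSet_ball
  exact absurd hRC (not_lt.2 (ENNReal.div_le_of_le_mul (hC _ hint hDt)))
end
end

section
/- Let 0 < α < n, let Φ be an Orlicz function and 0 ≤ λ < 1. Suppose that ∫_{|B_r|}^{∞} t^{α/n} Φ⁻¹(t^{λ−1}) dt/t < ∞ for every r > 0. Then for every f ∈ M^{Φ,λ}(0): (a) ∫_{B_{2r}} (1+|y|)^{α−n} |f(y)| dy < ∞ for every r > 0; and (b) the Riesz potential I_α f is well-defined, i.e., ∫_{ℝⁿ} |f(y)| |x−y|^{α−n} dy < ∞ for almost every x ∈ ℝⁿ. -/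
open MeasureTheory Metric Set Filter ENNReal NNReal Topology

noncomputable section

theorem IsOrliczFn.mul_le_mul_of_le {Φ : ℝ≥0∞ → ℝ≥0∞} (hΦ : IsOrliczFn Φ) {u t : ℝ≥0∞}
    (hut : u ≤ t) (ht : t ≠ ∞) : t * Φ u ≤ u * Φ t := by
  rcases eq_or_ne t 0 with rfl | ht0
  · simp
  have h := hΦ.convex t 0 (u / t) (ENNReal.div_le_of_le_mul (by simpa using hut))
  rw [ENNReal.div_mul_cancel ht0 ht, mul_zero, hΦ.map_zero, mul_zero, add_zero, add_zero] at h
  calc t * Φ u ≤ t * (u / t * Φ t) := by gcongr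
    _ = u / t * t * Φ t := by ring
    _ = u * Φ t := by rw [ENNReal.div_mul_cancel ht0 ht]

theorem IsOrliczFn.le_add_div_mul {Φ : ℝ≥0∞ → ℝ≥0∞} (hΦ : IsOrliczFn Φ) {u v t : ℝ≥0∞}
    (huv : v < Φ u) (hv : v ≠ 0) (ht : t ≠ ∞) : t ≤ u + u / v * Φ t := by
  rcases le_total t u with h | h
  · exact h.trans le_self_add
  · refine le_add_left ?_
    have h1 := hΦ.mul_le_mul_of_le h ht
    rw [ENNReal.mul_div_right_comm.symm, ENNReal.le_div_iff_mul_le (.inl hv) (.inl huv.ne_top)]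
    exact le_trans (by gcongr) h1

/-- A Jensen-type bound of the mean of `g` in terms of its Orlicz modular. -/
theorem IsOrliczFn.lintegral_le_of_modular_le {X : Type*} [MeasurableSpace X] {μ : Measure X}
    {Φ : ℝ≥0∞ → ℝ≥0∞} (hΦ : IsOrliczFn Φ) {lam : ℝ} {A : Set X} (hA0 : μ A ≠ 0) (hA : μ A ≠ ∞)
    {g : X → ℝ≥0∞} (hg : ∀ x, g x ≠ ∞) {ε : ℝ≥0∞} (hε0 : ε ≠ 0) (hε : ε ≠ ∞)
    (hmod : μ A ^ (-lam) * ∫⁻ x in A, Φ (g x / ε) ∂μ ≤ 1) :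
    ∫⁻ x in A, g x ∂μ ≤ 2 * ε * (μ A * yInv Φ (μ A ^ (lam - 1))) := by
  have hmod' : ∫⁻ x in A, Φ (g x / ε) ∂μ ≤ μ A ^ lam := by
    rw [ENNReal.rpow_neg, mul_comm, ← div_eq_mul_inv] at hmod
    simpa using ENNReal.div_le_iff_le_mul
      (.inl ((ENNReal.rpow_pos hA0.bot_lt hA).ne'))
      (.inl (ENNReal.rpow_ne_top_of_ne_zero hA0 hA)) |>.1 hmod
  have hv0 : μ A ^ (lam - 1) ≠ 0 := (ENNReal.rpow_pos hA0.bot_lt hA).ne'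
  have hvt : μ A ^ (lam - 1) ≠ ∞ := ENNReal.rpow_ne_top_of_ne_zero hA0 hA
  have hdiv : (∫⁻ x in A, g x ∂μ) / (2 * ε * μ A) ≤ yInv Φ (μ A ^ (lam - 1)) := by
    refine le_sInf fun u hu => ?_
    rw [mem_ofPred_eq] at hu
    rcases eq_or_ne u ∞ with rfl | hut
    · exact le_top
    rw [ENNReal.div_le_iff (by simp [hA0, hε0]) (by finiteness)]
    calc ∫⁻ x in A, g x ∂μ
        ≤ ∫⁻ x in A, ε * (u + u / μ A ^ (lam - 1) * Φ (g x / ε)) ∂μ := by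
          refine lintegral_mono fun x => ?_
          calc g x = ε * (g x / ε) := (ENNReal.mul_div_cancel hε0 hε).symm
            _ ≤ _ := by
              gcongr
              exact hΦ.le_add_div_mul hu hv0 (ENNReal.div_ne_top (hg x) hε0)
      _ = ε * (u * μ A + u / μ A ^ (lam - 1) * ∫⁻ x in A, Φ (g x / ε) ∂μ) := by
          rw [lintegral_const_mul' _ _ hε, lintegral_add_left measurable_const,
            lintegral_const_mul' _ _ (ENNReal.div_ne_top hut hv0), setLIntegral_const]
      _ ≤ ε * (u * μ A + u / μ A ^ (lam - 1) * μ A ^ lam) := by gcongr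
      _ = u * (2 * ε * μ A) := by
          have : μ A ^ lam = μ A ^ (lam - 1) * μ A := by
            conv_rhs => rw [← ENNReal.rpow_one (μ A), ← ENNReal.rpow_mul, one_mul,
              ← ENNReal.rpow_add _ _ hA0 hA]
            congr 1; ring
          rw [this, ← mul_assoc, ENNReal.div_mul_cancel hv0 hvt]
          ring
  rw [ENNReal.div_le_iff (by simp [hA0, hε0]) (by finiteness)] at hdiv
  exact hdiv.trans_eq (by ring)

theorem exists_lintegral_ball_le_of_centralNorm_ne_top {n : ℕ} {Φ : ℝ≥0∞ → ℝ≥0∞}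
    (hΦ : IsOrliczFn Φ) {lam : ℝ} {f : Eu n → ℝ} (hfin : centralNorm Φ lam f ≠ ∞) :
    ∃ C : ℝ≥0∞, C ≠ ∞ ∧ ∀ r : ℝ, 0 < r → ∫⁻ y in ball (0 : Eu n) r, (‖f y‖₊ : ℝ≥0∞) ≤
      C * (volume (ball (0 : Eu n) r) *
        yInv Φ (volume (ball (0 : Eu n) r) ^ (lam - 1))) := by
  refine ⟨2 * (centralNorm Φ lam f + 1), by finiteness, fun r hr => ?_⟩
  have hlt : orliczNorm Φ lam (ball (0 : Eu n) r) f < centralNorm Φ lam f + 1 :=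
    (le_iSup₂ (f := fun (r : ℝ) (_ : 0 < r) => orliczNorm Φ lam (ball (0 : Eu n) r) f) r hr
      ).trans_lt (ENNReal.lt_add_right hfin one_ne_zero)
  obtain ⟨ε, ⟨hε0, hε, hmod⟩, hεlt⟩ := sInf_lt_iff.1 hlt
  refine (hΦ.lintegral_le_of_modular_le (measure_ball_pos _ _ hr).ne' measure_ball_lt_top.ne
    (fun _ => by finiteness) hε0.ne' hε hmod).trans ?_
  gcongr

theorem volume_ball_eq_ofReal {n : ℕ} (hn : n ≠ 0) {r : ℝ} (hr : 0 ≤ r) :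
    volume (ball (0 : Eu n) r) =
      ENNReal.ofReal ((volume (ball (0 : Eu n) 1)).toReal * r ^ n) := by
  have : NeZero n := ⟨hn⟩
  rw [Measure.addHaar_ball _ _ hr, finrank_euclideanSpace_fin, mul_comm,
    ENNReal.ofReal_mul ENNReal.toReal_nonneg, ENNReal.ofReal_toReal measure_ball_lt_top.ne]

theorem lintegral_Ioi_rpow {a c : ℝ} (ha : a < -1) (hc : 0 < c) :
    ∫⁻ t in Ioi c, ENNReal.ofReal (t ^ a) = ENNReal.ofReal (-c ^ (a + 1) / (a + 1)) := by
  rw [← integral_Ioi_rpow_of_lt ha hc, ofReal_integral_eq_lintegral_ofReal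
    (integrableOn_Ioi_rpow_of_lt ha hc)]
  exact (ae_restrict_mem measurableSet_Ioi).mono fun t ht => Real.rpow_nonneg (hc.trans ht).le _

theorem ofReal_rpow_sub_eq_lintegral {n : ℕ} {α : ℝ} (hn : n ≠ 0) (hαn : α < n) {v s : ℝ}
    (hv : 0 < v) (hs : 0 < s) :
    ENNReal.ofReal (s ^ (α - n)) = ENNReal.ofReal (v ^ (1 - α / n) * (1 - α / n)) *
      ∫⁻ t in Ioi (v * s ^ n), ENNReal.ofReal (t ^ (α / n - 2)) := by
  have hn0 : (0 : ℝ) < n := by positivity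
  have h1 : α / n < 1 := (div_lt_one hn0).2 hαn
  have h1' : 0 < 1 - α / n := by linarith
  rw [lintegral_Ioi_rpow (by linarith) (by positivity), ← ENNReal.ofReal_mul (by positivity)]
  congr 1
  have e1 : α / n - 2 + 1 = -(1 - α / n) := by ring
  rw [e1, Real.mul_rpow hv.le (by positivity), neg_div_neg_eq, ← Real.rpow_natCast s n,
    ← Real.rpow_mul hs.le, show (n : ℝ) * -(1 - α / n) = α - n by field_simp; ring,
    Real.rpow_neg hv.le]
  have : v ^ (1 - α / n) ≠ 0 := by positivity
  field_simp
  rw [div_self (by linarith)]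

theorem setLIntegral_norm_rpow_le {n : ℕ} {α : ℝ} (hn : n ≠ 0) (hαn : α < n) {ρ : ℝ} (hρ : 0 < ρ)
    {g : Eu n → ℝ≥0∞} (hg : AEMeasurable g) :
    ∃ C : ℝ≥0∞, C ≠ ∞ ∧
      ∫⁻ y in (ball (0 : Eu n) ρ)ᶜ, g y * ENNReal.ofReal (‖y‖ ^ (α - n)) ≤
        C * ∫⁻ t in Ioi (volume (ball (0 : Eu n) ρ)).toReal, ENNReal.ofReal (t ^ (α / n - 2)) *
          ∫⁻ y in {y : Eu n | (volume (ball (0 : Eu n) 1)).toReal * ‖y‖ ^ n < t}, g y := by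
  set v := (volume (ball (0 : Eu n) 1)).toReal with hv_def
  have hv : 0 < v :=
    ENNReal.toReal_pos (measure_ball_pos _ _ one_pos).ne' measure_ball_lt_top.ne
  have hvol : (volume (ball (0 : Eu n) ρ)).toReal = v * ρ ^ n := by
    rw [volume_ball_eq_ofReal hn hρ.le, ENNReal.toReal_ofReal (by positivity)]
  rw [hvol]
  set k : ℝ → ℝ≥0∞ := fun t => ENNReal.ofReal (t ^ (α / n - 2)) with hk_def
  have hk : Measurable k := by fun_prop
  set T : Set (Eu n × ℝ) := {p | v * ‖p.1‖ ^ n < p.2} with hT_def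
  have hT : MeasurableSet T := measurableSet_lt (by fun_prop) (by fun_prop)
  refine ⟨ENNReal.ofReal (v ^ (1 - α / n) * (1 - α / n)), by finiteness, ?_⟩
  set c := ENNReal.ofReal (v ^ (1 - α / n) * (1 - α / n))
  have hmeas : AEMeasurable (Function.uncurry fun (y : Eu n) (t : ℝ) =>
      T.indicator (fun p => g p.1 * k p.2) (y, t))
      ((volume.restrict (ball (0 : Eu n) ρ)ᶜ).prod (volume.restrict (Ioi (v * ρ ^ n)))) := by
    have h1 : AEMeasurable (fun p : Eu n × ℝ => g p.1)
        ((volume.restrict (ball (0 : Eu n) ρ)ᶜ).prod (volume.restrict (Ioi (v * ρ ^ n)))) :=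
      hg.restrict.comp_quasiMeasurePreserving Measure.quasiMeasurePreserving_fst
    exact (h1.mul (hk.comp measurable_snd).aemeasurable).indicator hT
  calc ∫⁻ y in (ball (0 : Eu n) ρ)ᶜ, g y * ENNReal.ofReal (‖y‖ ^ (α - n))
      = ∫⁻ y in (ball (0 : Eu n) ρ)ᶜ, c * ∫⁻ t in Ioi (v * ρ ^ n),
          T.indicator (fun p => g p.1 * k p.2) (y, t) := by
        refine setLIntegral_congr_fun measurableSet_ball.compl fun y hy => ?_
        have hy' : ρ ≤ ‖y‖ := by simpa using hy
        have hsub : Ioi (v * ‖y‖ ^ n) ⊆ Ioi (v * ρ ^ n) :=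
          Ioi_subset_Ioi (by gcongr)
        have hind : (fun t => T.indicator (fun p => g p.1 * k p.2) (y, t)) =
            (Ioi (v * ‖y‖ ^ n)).indicator fun t => g y * k t := by
          ext t; simp [T, indicator]
        simp only [hind]
        rw [setLIntegral_indicator measurableSet_Ioi, inter_eq_left.2 hsub,
          lintegral_const_mul _ hk, ofReal_rpow_sub_eq_lintegral hn hαn hv (hρ.trans_le hy')]
        ring
    _ = c * ∫⁻ t in Ioi (v * ρ ^ n), ∫⁻ y in (ball (0 : Eu n) ρ)ᶜ,
          T.indicator (fun p => g p.1 * k p.2) (y, t) := by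
        rw [lintegral_const_mul' _ _ (by finiteness), lintegral_lintegral_swap hmeas]
    _ ≤ c * ∫⁻ t in Ioi (v * ρ ^ n), k t * ∫⁻ y in {y : Eu n | v * ‖y‖ ^ n < t}, g y := by
        gcongr with t
        have hind : (fun y => T.indicator (fun p => g p.1 * k p.2) (y, t)) =
            {y : Eu n | v * ‖y‖ ^ n < t}.indicator fun y => k t * g y := by
          ext y; simp [T, indicator, mul_comm]
        rw [hind]
        refine (setLIntegral_le_lintegral _ _).trans ?_
        rw [lintegral_indicator (measurableSet_lt (by fun_prop) (by fun_prop)),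
          lintegral_const_mul' _ _ (by finiteness)]

theorem lintegral_compl_ball_ne_top {n : ℕ} {α : ℝ} (hn : n ≠ 0) (hαn : α < n)
    {Φ : ℝ≥0∞ → ℝ≥0∞} (hΦ : IsOrliczFn Φ) {lam : ℝ} {ρ : ℝ} (hρ : 0 < ρ)
    (hconv : (∫⁻ s in Ioi (volume (ball (0 : Eu n) ρ)).toReal,
        ENNReal.ofReal (s ^ (α / n)) * yInv Φ (ENNReal.ofReal (s ^ (lam - 1))) /
          ENNReal.ofReal s) ≠ ∞)
    {f : Eu n → ℝ} (hf : AEStronglyMeasurable f) (hfin : centralNorm Φ lam f ≠ ∞) :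
    ∫⁻ y in (ball (0 : Eu n) ρ)ᶜ, (‖f y‖₊ : ℝ≥0∞) * ENNReal.ofReal (‖y‖ ^ (α - n)) ≠ ∞ := by
  obtain ⟨D, hD, hball⟩ := exists_lintegral_ball_le_of_centralNorm_ne_top hΦ hfin
  obtain ⟨C, hC, hle⟩ := setLIntegral_norm_rpow_le hn hαn hρ
    (g := fun y => (‖f y‖₊ : ℝ≥0∞)) hf.enorm
  set v := (volume (ball (0 : Eu n) 1)).toReal with hv_def
  have hv : 0 < v :=
    ENNReal.toReal_pos (measure_ball_pos _ _ one_pos).ne' measure_ball_lt_top.ne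
  refine ne_top_of_le_ne_top (ENNReal.mul_ne_top hC (ENNReal.mul_ne_top hD hconv)) (hle.trans ?_)
  gcongr
  rw [← lintegral_const_mul' _ _ hD]
  refine setLIntegral_mono' measurableSet_Ioi fun t ht => ?_
  have ht0 : 0 < t := ENNReal.toReal_nonneg.trans_lt ht
  set r := (t / v) ^ (1 / n : ℝ)
  have hr : 0 < r := by positivity
  have hrn : v * r ^ n = t := by
    rw [← Real.rpow_natCast, ← Real.rpow_mul (by positivity),
      one_div_mul_cancel (by exact_mod_cast hn), Real.rpow_one]
    field_simp
  have hset : {y : Eu n | v * ‖y‖ ^ n < t} = ball 0 r := by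
    ext y
    rw [mem_ofPred_eq, mem_ball_zero_iff, ← hrn, mul_lt_mul_iff_right₀ hv,
      pow_lt_pow_iff_left₀ (norm_nonneg _) hr.le hn]
  have hb := hball r hr
  rw [volume_ball_eq_ofReal hn hr.le, ← hv_def, hrn, ENNReal.ofReal_rpow_of_pos ht0] at hb
  rw [hset]
  refine (mul_le_mul_right hb _).trans_eq ?_
  have hk : ENNReal.ofReal (t ^ (α / n - 2)) * ENNReal.ofReal t =
      ENNReal.ofReal (t ^ (α / n)) / ENNReal.ofReal t := by
    rw [← ENNReal.ofReal_mul (by positivity), ← ENNReal.ofReal_div_of_pos ht0]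
    congr 1
    rw [Real.rpow_sub ht0, Real.rpow_two]
    field_simp
  calc _ = D * ((ENNReal.ofReal (t ^ (α / n - 2)) * ENNReal.ofReal t) *
        yInv Φ (ENNReal.ofReal (t ^ (lam - 1)))) := by ring
    _ = _ := by rw [hk, ENNReal.mul_div_right_comm]

theorem lintegral_ball_norm_rpow_ne_top {n : ℕ} {α : ℝ} (hn : n ≠ 0) (hα : 0 < α) (ρ : ℝ) :
    ∫⁻ z in ball (0 : Eu n) ρ, ENNReal.ofReal (‖z‖ ^ (α - n)) ≠ ∞ := by
  have : NeZero n := ⟨hn⟩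
  have hint : IntegrableOn (fun z : Eu n => ‖z‖ ^ (α - n)) (ball 0 ρ) volume := by
    rw [integrableOn_fun_norm_addHaar volume (f := fun s : ℝ => s ^ (α - n)),
      finrank_euclideanSpace_fin]
    rcases le_or_gt ρ 0 with h | h
    · simp [Ioo_eq_empty h.not_gt]
    have h1 : IntegrableOn (fun s : ℝ => s ^ (α - 1)) (Ioo 0 ρ) := by
      rw [← integrableOn_Ioc_iff_integrableOn_Ioo,
        ← intervalIntegrable_iff_integrableOn_Ioc_of_le h.le]
      exact intervalIntegral.intervalIntegrable_rpow' (by linarith)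
    refine h1.congr_fun (fun s hs => ?_) measurableSet_Ioo
    rw [smul_eq_mul, ← Real.rpow_natCast, ← Real.rpow_add hs.1,
      Nat.cast_pred (Nat.pos_of_ne_zero hn)]
    beta_reduce
    congr 1; ring
  rw [← ofReal_integral_eq_lintegral_ofReal hint
    (ae_of_all _ fun z => Real.rpow_nonneg (norm_nonneg _) _)]
  finiteness

theorem ae_lintegral_ball_lt_top {n : ℕ} {α : ℝ} (hn : n ≠ 0) (hα : 0 < α) {g : Eu n → ℝ≥0∞}
    (hg : AEMeasurable g) (R : ℝ) (hgR : ∫⁻ y in ball (0 : Eu n) (2 * R), g y ≠ ∞) :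
    ∀ᵐ x ∂volume.restrict (ball (0 : Eu n) R),
      ∫⁻ y in ball (0 : Eu n) (2 * R), g y * ENNReal.ofReal (‖x - y‖ ^ (α - n)) < ∞ := by
  have hmeas : AEMeasurable (Function.uncurry fun (x y : Eu n) =>
      g y * ENNReal.ofReal (‖x - y‖ ^ (α - n)))
      ((volume.restrict (ball (0 : Eu n) R)).prod (volume.restrict (ball (0 : Eu n) (2 * R)))) := by
    have h1 : AEMeasurable (fun p : Eu n × Eu n => g p.2)
        ((volume.restrict (ball (0 : Eu n) R)).prod
          (volume.restrict (ball (0 : Eu n) (2 * R)))) :=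
      hg.restrict.comp_quasiMeasurePreserving Measure.quasiMeasurePreserving_snd
    refine h1.mul (Measurable.aemeasurable ?_)
    fun_prop
  refine ae_lt_top' hmeas.lintegral_prod_right' ?_
  rw [lintegral_lintegral_swap hmeas]
  set K := ∫⁻ z in ball (0 : Eu n) (3 * R), ENNReal.ofReal (‖z‖ ^ (α - n)) with hK_def
  have hK : K ≠ ∞ := lintegral_ball_norm_rpow_ne_top hn hα _
  refine ne_top_of_le_ne_top (ENNReal.mul_ne_top hgR hK) ?_
  rw [← lintegral_mul_const' _ _ hK]
  refine setLIntegral_mono' measurableSet_ball fun y hy => ?_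
  rw [lintegral_const_mul _ (by fun_prop)]
  gcongr
  rw [hK_def, ← lintegral_indicator measurableSet_ball, ← lintegral_indicator measurableSet_ball,
    ← lintegral_sub_right_eq_self ((ball (0 : Eu n) (3 * R)).indicator _) y]
  refine lintegral_mono fun x => ?_
  by_cases hx : x ∈ ball (0 : Eu n) R
  · have hxy : x - y ∈ ball (0 : Eu n) (3 * R) := by
      rw [mem_ball_zero_iff] at hx hy ⊢
      linarith [norm_sub_le x y]
    rw [indicator_of_mem hx, indicator_of_mem hxy]
  · simp [indicator_of_notMem hx]

theorem lintegral_compl_ball_sub_le {n : ℕ} {α : ℝ} (hαn : α ≤ n) {R : ℝ} (hR : 0 < R)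
    (g : Eu n → ℝ≥0∞) {x : Eu n} (hx : x ∈ ball (0 : Eu n) R) :
    ∫⁻ y in (ball (0 : Eu n) (2 * R))ᶜ, g y * ENNReal.ofReal (‖x - y‖ ^ (α - n)) ≤
      ENNReal.ofReal ((1 / 2) ^ (α - n)) *
        ∫⁻ y in (ball (0 : Eu n) (2 * R))ᶜ, g y * ENNReal.ofReal (‖y‖ ^ (α - n)) := by
  rw [← lintegral_const_mul' _ _ (by finiteness)]
  refine setLIntegral_mono' measurableSet_ball.compl fun y hy => ?_
  rw [mul_left_comm, ← ENNReal.ofReal_mul (by positivity),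
    ← Real.mul_rpow (by norm_num) (norm_nonneg _)]
  have hy' : 2 * R ≤ ‖y‖ := by simpa using hy
  rw [mem_ball_zero_iff] at hx
  have h := norm_sub_norm_le y x
  rw [norm_sub_rev] at h
  gcongr g y * ENNReal.ofReal ?_
  exact Real.rpow_le_rpow_of_nonpos (by linarith) (by linarith) (by linarith)

/-- well-definedness of the Riesz potential on central Morrey–Orlicz spaces. -/
theorem statement12 {n : ℕ} (α : ℝ) (hα : 0 < α) (hαn : α < n)
    (Φ : ℝ≥0∞ → ℝ≥0∞) (hΦ : IsOrliczFn Φ) (lam : ℝ) (hlam0 : 0 ≤ lam) (hlam1 : lam < 1)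
    (hconv : ∀ r : ℝ, 0 < r →
      (∫⁻ s in Ioi (volume (ball (0 : Eu n) r)).toReal,
        ENNReal.ofReal (s ^ (α / n)) * yInv Φ (ENNReal.ofReal (s ^ (lam - 1))) /
          ENNReal.ofReal s) ≠ ∞)
    (f : Eu n → ℝ) (hf : LocallyIntegrable f volume) (hfin : centralNorm Φ lam f ≠ ∞) :
    (∀ r : ℝ, 0 < r →
      (∫⁻ y in ball (0 : Eu n) (2 * r),
        ENNReal.ofReal ((1 + ‖y‖) ^ (α - n)) * (‖f y‖₊ : ℝ≥0∞)) < ∞) ∧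
    (∀ᵐ x : Eu n ∂volume,
      (∫⁻ y, (‖f y‖₊ : ℝ≥0∞) * ENNReal.ofReal (‖x - y‖ ^ (α - n))) < ∞) := by
  have hn : n ≠ 0 := by
    rintro rfl
    exact lt_asymm hα (by simpa using hαn)
  have hloc (r : ℝ) : ∫⁻ y in ball (0 : Eu n) r, (‖f y‖₊ : ℝ≥0∞) < ∞ :=
    ((hf.integrableOn_isCompact (isCompact_closedBall 0 r)).mono_set
      ball_subset_closedBall).hasFiniteIntegral
  refine ⟨fun r _ => (lintegral_mono fun y => ?_).trans_lt (hloc (2 * r)), ?_⟩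
  · refine mul_le_of_le_one_left' (ENNReal.ofReal_le_one.2 ?_)
    exact Real.rpow_le_one_of_one_le_of_nonpos (by linarith [norm_nonneg y]) (by linarith)
  have hmeas : AEMeasurable fun y => (‖f y‖₊ : ℝ≥0∞) := hf.aestronglyMeasurable.enorm
  have key (k : ℕ) : ∀ᵐ x : Eu n, x ∈ ball (0 : Eu n) (k + 1) →
      ∫⁻ y, (‖f y‖₊ : ℝ≥0∞) * ENNReal.ofReal (‖x - y‖ ^ (α - n)) < ∞ := by
    have hk : (0 : ℝ) < k + 1 := by positivity
    filter_upwards [(ae_restrict_iff' measurableSet_ball).1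
      (ae_lintegral_ball_lt_top hn hα hmeas (k + 1) (hloc _).ne)] with x hx hxk
    rw [← lintegral_add_compl _ (measurableSet_ball (x := (0 : Eu n)) (ε := 2 * (k + 1)))]
    refine ENNReal.add_lt_top.2 ⟨hx hxk, (lintegral_compl_ball_sub_le hαn.le hk _ hxk).trans_lt ?_⟩
    exact ENNReal.mul_lt_top ENNReal.ofReal_lt_top (lintegral_compl_ball_ne_top hn hαn hΦ
      (by positivity) (hconv _ (by positivity)) hf.aestronglyMeasurable hfin).lt_top
  filter_upwards [ae_all_iff.2 key] with x hx
  obtain ⟨k, hk⟩ := exists_nat_gt ‖x‖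
  exact hx k (by rw [mem_ball_zero_iff]; linarith)
end
end
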